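/- Let n ≥ 3, let V ∈ B_q(ℝⁿ) for some q > n/2 with V not identically zero, and let 0 < α < 1. Then BMO^α_𝓛(ℝⁿ) = Λ^α_𝓛(ℝⁿ) with equivalent norms: a locally integrable f belongs to BMO^α_𝓛(ℝⁿ) if and only if f agrees almost everywhere with a function g satisfying the Λ^α_𝓛 conditions, and there is a constant C ≥ 1, independent of f, with C⁻¹ ‖f‖_{BMO^α_𝓛} ≤ ‖g‖_{Λ^α_𝓛} ≤ C ‖f‖_{BMO^α_𝓛}. -/

import Mathlib

open MeasureTheory Metric Set
open RealInnerProductSpace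

noncomputable section

abbrev En (n : ℕ) := EuclideanSpace ℝ (Fin n)

/-- Reverse Hölder inequality with constant `C`. -/
def ReverseHolderWith (m : ℕ) (q : ℝ) (W : En m → ℝ) (C : ℝ) : Prop :=
  (∀ x, 0 ≤ W x) ∧ LocallyIntegrable W volume ∧
  LocallyIntegrable (fun y => W y ^ q) volume ∧
  ∀ (x : En m) (r : ℝ), 0 < r →
    ((volume (ball x r)).toReal⁻¹ * ∫ y in ball x r, W y ^ q) ^ q⁻¹
      ≤ C * ((volume (ball x r)).toReal⁻¹ * ∫ y in ball x r, W y)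

/-- The reverse Hölder class `B_q`. -/
def ReverseHolder (m : ℕ) (q : ℝ) (W : En m → ℝ) : Prop :=
  ∃ C : ℝ, 0 < C ∧ ReverseHolderWith m q W C

/-- The critical radius function `ρ`. -/
def criticalRadius (m : ℕ) (V : En m → ℝ) (x : En m) : ℝ :=
  sSup {r : ℝ | 0 < r ∧ r ^ ((2 : ℝ) - m) * ∫ y in ball x r, V y ≤ 1}

/-- Weak solution of `∂ₜ u − Δu + V u = 0` on the region `S`. -/
def IsCaloricOn (n : ℕ) (V : En n → ℝ) (u : En n → ℝ → ℝ) (S : Set (En n × ℝ)) : Prop :=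
  ∀ ψ : En n → ℝ → ℝ,
    ContDiff ℝ 1 (fun p : En n × ℝ => ψ p.1 p.2) →
    HasCompactSupport (fun p : En n × ℝ => ψ p.1 p.2) →
    tsupport (fun p : En n × ℝ => ψ p.1 p.2) ⊆ S →
    ((∫ p : En n × ℝ, ⟪gradient (fun y => u y p.2) p.1, gradient (fun y => ψ y p.2) p.1⟫)
      - ∫ p : En n × ℝ, u p.1 p.2 * deriv (ψ p.1) p.2)
      + ∫ p : En n × ℝ, V p.1 * u p.1 p.2 * ψ p.1 p.2 = 0

/-- `TMOBound n u M` : the TMO (Carleson-type) condition `‖u‖_{TMO} ≤ M`. -/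
def TMOBound (n : ℕ) (u : En n → ℝ → ℝ) (M : ℝ) : Prop :=
  ∀ (x : En n) (r : ℝ), 0 < r →
    (∫ t in Set.Ioc (0 : ℝ) (r ^ 2), ∫ y in ball x r,
        (‖gradient (fun z => u z t) y‖ ^ 2 + (deriv (u y) t) ^ 2))
      ≤ M ^ 2 * r ^ n


/-- `BMOAlphaBound n V α f C` : `f` satisfies the defining inequalities of
`BMO^α_𝓛(ℝⁿ)` with constant `C`. -/
def BMOAlphaBound (n : ℕ) (V : En n → ℝ) (α : ℝ) (f : En n → ℝ) (C : ℝ) : Prop :=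
  (∀ (x : En n) (r : ℝ), 0 < r →
      (∫ y in ball x r,
          |f y - (volume (ball x r)).toReal⁻¹ * ∫ z in ball x r, f z|)
        ≤ C * r ^ ((n : ℝ) + α)) ∧
  (∀ (x : En n) (r : ℝ), criticalRadius n V x ≤ r →
      (∫ y in ball x r, |f y|) ≤ C * r ^ ((n : ℝ) + α))

/-- `LambdaBound n V α g C` : `g` satisfies the defining inequalities of
`Λ^α_𝓛(ℝⁿ)` with constant `C`. -/
def LambdaBound (n : ℕ) (V : En n → ℝ) (α : ℝ) (g : En n → ℝ) (C : ℝ) : Prop :=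
  (∀ x y : En n, |g x - g y| ≤ C * dist x y ^ α) ∧
  (∀ x : En n, |g x| ≤ C * criticalRadius n V x ^ α)

open Filter Topology

/-- The average of `f` over the open ball `ball x r`. -/
def ballAverage (n : ℕ) (f : En n → ℝ) (x : En n) (r : ℝ) : ℝ :=
  (volume (ball x r)).toReal⁻¹ * ∫ z in ball x r, f z

/-- The volume of the unit ball. -/
def unitBallVolume (n : ℕ) : ℝ := (volume (ball (0 : En n) 1)).toReal

lemma unitBallVolume_pos (n : ℕ) : 0 < unitBallVolume n :=
  ENNReal.toReal_pos (measure_ball_pos _ _ one_pos).ne' measure_ball_lt_top.ne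

lemma volume_ball_toReal (n : ℕ) (x : En n) {r : ℝ} (hr : 0 < r) :
    (volume (ball x r)).toReal = r ^ n * unitBallVolume n := by
  have h := Measure.addHaar_ball_mul_of_pos (volume : Measure (En n)) x hr 1
  rw [mul_one] at h
  rw [h, ENNReal.toReal_mul, ENNReal.toReal_ofReal (by positivity), finrank_euclideanSpace_fin,
    unitBallVolume]

lemma volume_ball_toReal_pos (n : ℕ) (x : En n) {r : ℝ} (hr : 0 < r) :
    0 < (volume (ball x r)).toReal := by
  rw [volume_ball_toReal n x hr]
  have := unitBallVolume_pos n
  positivity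

lemma integrableOn_ball {n : ℕ} {f : En n → ℝ} (hf : LocallyIntegrable f volume)
    (x : En n) (r : ℝ) : IntegrableOn f (ball x r) volume :=
  (hf.integrableOn_isCompact (isCompact_closedBall x r)).mono_set ball_subset_closedBall

/-- Deviation of a ball average from a constant, controlled on a larger ball. -/
lemma abs_ballAverage_sub_le {n : ℕ} {f : En n → ℝ} (hf : LocallyIntegrable f volume)
    {x y : En n} {r s : ℝ} (hs : 0 < s) (hsub : ball y s ⊆ ball x r) (a : ℝ) :
    |ballAverage n f y s - a| ≤
      (s ^ n * unitBallVolume n)⁻¹ * ∫ z in ball x r, |f z - a| := by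
  have hv := volume_ball_toReal_pos n y hs
  have hconst (u : En n) (t : ℝ) : IntegrableOn (fun _ : En n => a) (ball u t) volume :=
    integrableOn_const measure_ball_lt_top.ne
  have h1 : ballAverage n f y s - a =
      (volume (ball y s)).toReal⁻¹ * ∫ z in ball y s, (f z - a) := by
    rw [integral_sub (integrableOn_ball hf y s) (hconst y s), setIntegral_const, mul_sub,
      ballAverage, smul_eq_mul, measureReal_def, inv_mul_cancel_left₀ hv.ne']
  rw [h1, abs_mul, abs_of_pos (inv_pos.2 hv), volume_ball_toReal n y hs]
  have := unitBallVolume_pos n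
  refine mul_le_mul_of_nonneg_left ((abs_integral_le_integral_abs).trans ?_) (by positivity)
  exact setIntegral_mono_set ((integrableOn_ball hf x r).sub (hconst x r)).abs
    (Eventually.of_forall fun _ => abs_nonneg _) hsub.eventuallyLE

/-- A function with dyadic increments `O(r ^ α)` has a limit at `0`, approached at rate
`O(r ^ α)`. -/
lemma exists_limit_of_dyadic_bound {A : ℝ → ℝ} {k α : ℝ} (hk : 0 ≤ k) (hα : 0 < α)
    (hA : ∀ r s : ℝ, 0 < r → r / 2 ≤ s → s ≤ r → |A s - A r| ≤ k * r ^ α) :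
    ∃ L : ℝ, Tendsto A (𝓝[>] 0) (𝓝 L) ∧
      ∀ r : ℝ, 0 < r → |L - A r| ≤ k / (1 - (1 / 2) ^ α) * r ^ α := by
  have hβ : ((1 : ℝ) / 2) ^ α < 1 := Real.rpow_lt_one (by norm_num) (by norm_num) hα
  have hβ0 : 0 < ((1 : ℝ) / 2) ^ α := by positivity
  set β := ((1 : ℝ) / 2) ^ α with hβdef
  set K := k / (1 - β) with hK
  have hKβ : K * β + k = K := by
    have : 1 - β ≠ 0 := by linarith
    rw [hK]; field_simp; ring
  have hK0 : 0 ≤ K := div_nonneg hk (by linarith)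
  have hkK : k ≤ K := by nlinarith
  have key : ∀ m : ℕ, ∀ r s : ℝ, 0 < r → r / 2 ^ m ≤ s → s ≤ r → |A s - A r| ≤ K * r ^ α := by
    intro m
    induction m with
    | zero =>
      intro r s hr h1 h2
      have : s = r := by
        rw [pow_zero, div_one] at h1
        exact le_antisymm h2 h1
      rw [this, sub_self, abs_zero]
      positivity
    | succ m ih =>
      intro r s hr h1 h2
      rcases le_total (r / 2) s with h | h
      · exact (hA r s hr h h2).trans (by gcongr)
      · have e1 := ih (r / 2) s (by positivity) (by rw [div_div, ← pow_succ']; exact h1) h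
        have e2 := hA r (r / 2) hr le_rfl (by linarith)
        have e3 : (r / 2) ^ α = β * r ^ α := by
          rw [hβdef, ← Real.mul_rpow (by norm_num) hr.le]; congr 1; ring
        calc |A s - A r| ≤ |A s - A (r / 2)| + |A (r / 2) - A r| := abs_sub_le _ _ _
          _ ≤ K * (β * r ^ α) + k * r ^ α := by rw [← e3]; exact add_le_add e1 e2
          _ = (K * β + k) * r ^ α := by ring
          _ = K * r ^ α := by rw [hKβ]
  have key' : ∀ r s : ℝ, 0 < s → s ≤ r → |A s - A r| ≤ K * r ^ α := by
    intro r s hs hsr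
    obtain ⟨m, hm⟩ := pow_unbounded_of_one_lt (r / s) (one_lt_two)
    refine key m r s (hs.trans_le hsr) ?_ hsr
    rw [div_lt_iff₀ hs] at hm
    rw [div_le_iff₀ (by positivity)]
    linarith
  have hlim : Tendsto (fun r : ℝ => K * r ^ α) (𝓝[>] 0) (𝓝 0) := by
    have : ContinuousAt (fun r : ℝ => K * r ^ α) 0 :=
      continuousAt_const.mul (Real.continuousAt_rpow_const _ _ (Or.inr hα.le))
    have h := this.tendsto
    simp only [Real.zero_rpow hα.ne', mul_zero] at h
    exact h.mono_left nhdsWithin_le_nhds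
  have hC : Cauchy (map A (𝓝[>] 0)) := by
    rw [Metric.cauchy_iff]
    refine ⟨inferInstance, fun ε hε => ?_⟩
    obtain ⟨r, hr, hr0⟩ :=
      ((hlim.eventually (gt_mem_nhds (half_pos hε))).and self_mem_nhdsWithin).exists
    have hr0 : 0 < r := hr0
    refine ⟨Set.image A (Ioc 0 r), image_mem_map (Ioc_mem_nhdsGT hr0), ?_⟩
    rintro _ ⟨s, hs, rfl⟩ _ ⟨t, ht, rfl⟩
    have e1 := key' r s hs.1 hs.2
    have e2 := key' r t ht.1 ht.2
    rw [Real.dist_eq]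
    have := abs_sub_le (A s) (A r) (A t)
    rw [abs_sub_comm (A r) (A t)] at this
    linarith
  obtain ⟨L, hL⟩ := cauchy_map_iff_exists_tendsto.1 hC
  refine ⟨L, hL, fun r hr => le_of_tendsto (hL.sub_const (A r)).abs ?_⟩
  filter_upwards [Ioc_mem_nhdsGT hr] with s hs using key' r s hs.1 hs.2

/-- Lebesgue differentiation along averages over centred open balls. -/
lemma ae_tendsto_ballAverage {n : ℕ} {f : En n → ℝ} (hf : LocallyIntegrable f volume) :
    ∀ᵐ x ∂(volume : Measure (En n)),
      Tendsto (ballAverage n f x) (𝓝[>] 0) (𝓝 (f x)) := by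
  filter_upwards [IsUnifLocDoublingMeasure.ae_tendsto_average
    (volume : Measure (En n)) hf 1] with x hx
  have h := hx (l := 𝓝[>] (0 : ℝ)) (fun _ => x) id tendsto_id (by
    filter_upwards [self_mem_nhdsWithin] with r hr
    exact mem_closedBall_self (by simpa using le_of_lt hr))
  refine h.congr' ?_
  filter_upwards [self_mem_nhdsWithin] with r hr
  have hr : 0 < r := hr
  have hae : (closedBall x r : Set (En n)) =ᵐ[volume] ball x r := by
    rw [← ball_union_sphere]
    exact union_ae_eq_left_of_ae_eq_empty
      (ae_eq_empty.2 (Measure.addHaar_sphere_of_ne_zero _ x hr.ne'))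
  rw [id, setAverage_congr hae, setAverage_eq, smul_eq_mul, measureReal_def, ballAverage]

/-- Campanato's theorem on `ℝⁿ`, with the rate at which ball averages converge. -/
lemma exists_holder_representative {n : ℕ} {α : ℝ} (hα : 0 < α) {f : En n → ℝ}
    (hf : LocallyIntegrable f volume) {M : ℝ} (hM : 0 ≤ M)
    (hosc : ∀ (x : En n) (r : ℝ), 0 < r →
      (∫ y in ball x r, |f y - ballAverage n f x r|) ≤ M * r ^ ((n : ℝ) + α)) :
    ∃ g : En n → ℝ, (∀ᵐ x ∂(volume : Measure (En n)), f x = g x) ∧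
      (∀ x r, 0 < r → |g x - ballAverage n f x r| ≤
        M * (2 ^ n / unitBallVolume n) / (1 - (1 / 2) ^ α) * r ^ α) ∧
      ∀ x y, |g x - g y| ≤
        2 * (M * (2 ^ n / unitBallVolume n) / (1 - (1 / 2) ^ α) +
          M * (2 ^ ((n : ℝ) + α) / unitBallVolume n)) * dist x y ^ α := by
  have hc := unitBallVolume_pos n
  set c := unitBallVolume n with hcdef
  have hcmp : ∀ (x y : En n) (r s : ℝ), 0 < r → 0 < s → ball y s ⊆ ball x r →
      |ballAverage n f y s - ballAverage n f x r| ≤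
        (s ^ n * c)⁻¹ * (M * r ^ ((n : ℝ) + α)) := fun x y r s hr hs hsub =>
    (abs_ballAverage_sub_le hf hs hsub _).trans
      (mul_le_mul_of_nonneg_left (hosc x r hr) (by positivity))
  have hdy : ∀ x : En n, ∀ r s : ℝ, 0 < r → r / 2 ≤ s → s ≤ r →
      |ballAverage n f x s - ballAverage n f x r| ≤ M * (2 ^ n / c) * r ^ α := by
    intro x r s hr h1 h2
    refine (hcmp x x r s hr (by linarith) (ball_subset_ball h2)).trans ?_
    calc (s ^ n * c)⁻¹ * (M * r ^ ((n : ℝ) + α))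
        ≤ ((r / 2) ^ n * c)⁻¹ * (M * r ^ ((n : ℝ) + α)) := by gcongr
      _ = M * (2 ^ n / c) * r ^ α := by
        rw [Real.rpow_add hr, Real.rpow_natCast, div_pow]
        field_simp
  choose g hgt hg using fun x =>
    exists_limit_of_dyadic_bound (by positivity : 0 ≤ M * (2 ^ n / c)) hα (hdy x)
  refine ⟨g, ?_, hg, fun x y => ?_⟩
  · filter_upwards [ae_tendsto_ballAverage hf] with x hx using tendsto_nhds_unique hx (hgt x)
  · rcases eq_or_ne x y with rfl | hxy
    · simp [Real.zero_rpow hα.ne']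
    set r := dist x y with hr
    have hr0 : 0 < r := dist_pos.2 hxy
    have e1 := hg x r hr0
    have e2 := hg y r hr0
    have hval : (r ^ n * c)⁻¹ * (M * (2 * r) ^ ((n : ℝ) + α)) =
        M * (2 ^ ((n : ℝ) + α) / c) * r ^ α := by
      rw [Real.mul_rpow (by norm_num) hr0.le, Real.rpow_add hr0, Real.rpow_natCast]
      field_simp
    have e3 := hcmp x x (2 * r) r (by linarith) hr0 (ball_subset_ball (by linarith))
    have e4 := hcmp x y (2 * r) r (by linarith) hr0
      (ball_subset_ball' (by rw [dist_comm y x]; linarith))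
    rw [hval] at e3 e4
    rw [abs_le] at *
    constructor <;> linarith [e1.1, e1.2, e2.1, e2.2, e3.1, e3.2, e4.1, e4.2]

/-- A Campanato-type bound with the decay condition at scales `r ≥ ρ(x)` gives a representative
satisfying the Hölder and growth conditions. -/
lemma exists_lambdaBound_of_bmoAlphaBound {n : ℕ} {V : En n → ℝ} {α : ℝ} (hα : 0 < α)
    {f : En n → ℝ} (hf : LocallyIntegrable f volume) {M C : ℝ} (hM : 0 ≤ M)
    (hC : 2 * ((2 ^ n / unitBallVolume n) / (1 - (1 / 2) ^ α) +
      2 ^ ((n : ℝ) + α) / unitBallVolume n) + (unitBallVolume n)⁻¹ ≤ C)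
    (h : BMOAlphaBound n V α f M) :
    ∃ g : En n → ℝ, (∀ᵐ x ∂(volume : Measure (En n)), f x = g x) ∧
      LambdaBound n V α g (C * M) := by
  obtain ⟨g, hfg, hg, hgh⟩ := exists_holder_representative hα hf hM h.1
  have hc := unitBallVolume_pos n
  set c := unitBallVolume n with hcdef
  have hβ : 0 < 1 - ((1 : ℝ) / 2) ^ α :=
    sub_pos.2 (Real.rpow_lt_one (by norm_num) (by norm_num) hα)
  set k₁ := (2 ^ n / c) / (1 - ((1 : ℝ) / 2) ^ α) with hk₁
  set k₂ := (2 : ℝ) ^ ((n : ℝ) + α) / c with hk₂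
  have hk₁0 : 0 < k₁ := by positivity
  have hk₂0 : 0 < k₂ := by positivity
  have hci : 0 < c⁻¹ := by positivity
  have hk₁M : M * (2 ^ n / c) / (1 - ((1 : ℝ) / 2) ^ α) = M * k₁ := by rw [hk₁]; ring
  rw [hk₁M] at hgh
  simp only [hk₁M] at hg
  have hρ0 : ∀ x, 0 ≤ criticalRadius n V x := fun x => Real.sSup_nonneg fun r hr => hr.1.le
  refine ⟨g, hfg, fun x y => (hgh x y).trans ?_, fun x => ?_⟩
  · refine mul_le_mul_of_nonneg_right ?_ (by positivity)
    nlinarith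
  · have key : ∀ r, criticalRadius n V x < r → |g x| ≤ C * M * r ^ α := by
      intro r hr
      have hr0 : 0 < r := (hρ0 x).trans_lt hr
      have e1 := hg x r hr0
      have e2 := abs_ballAverage_sub_le hf hr0 (subset_refl (ball x r)) 0
      simp only [sub_zero] at e2
      have e3 : |ballAverage n f x r| ≤ M * c⁻¹ * r ^ α := by
        calc |ballAverage n f x r| ≤ (r ^ n * c)⁻¹ * (M * r ^ ((n : ℝ) + α)) :=
              e2.trans (mul_le_mul_of_nonneg_left (h.2 x r hr.le) (by positivity))
          _ = M * c⁻¹ * r ^ α := by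
              rw [Real.rpow_add hr0, Real.rpow_natCast]
              field_simp
      have e4 : |g x| ≤ (M * k₁ + M * c⁻¹) * r ^ α := by
        have := abs_add_le (g x - ballAverage n f x r) (ballAverage n f x r)
        rw [sub_add_cancel] at this
        linarith
      refine e4.trans (mul_le_mul_of_nonneg_right ?_ (by positivity))
      nlinarith
    have hcont : Tendsto (fun r : ℝ => C * M * r ^ α) (𝓝[>] criticalRadius n V x)
        (𝓝 (C * M * criticalRadius n V x ^ α)) :=
      (continuousAt_const.mul
        (Real.continuousAt_rpow_const _ _ (Or.inr hα.le))).tendsto.mono_left nhdsWithin_le_nhds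
    refine ge_of_tendsto hcont ?_
    filter_upwards [self_mem_nhdsWithin] with r hr using key r hr

/-- Functions satisfying the Hölder and growth conditions satisfy the mean oscillation and decay
conditions. -/
lemma bmoAlphaBound_of_lambdaBound {n : ℕ} {V : En n → ℝ} {α : ℝ} (hα : 0 < α) (hα1 : α < 1)
    {f g : En n → ℝ} (hf : LocallyIntegrable f volume) {N C : ℝ} (hN : 0 ≤ N)
    (hC : 2 * unitBallVolume n ≤ C)
    (hfg : ∀ᵐ x ∂(volume : Measure (En n)), f x = g x) (hg : LambdaBound n V α g N) :
    BMOAlphaBound n V α f (C * N) := by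
  have hc := unitBallVolume_pos n
  have hint : ∀ (x : En n) (r K a : ℝ), 0 < r → K ≤ 2 * N * r ^ α →
      (∀ᵐ y ∂(volume : Measure (En n)), y ∈ ball x r → |f y - a| ≤ K) →
      (∫ y in ball x r, |f y - a|) ≤ C * N * r ^ ((n : ℝ) + α) := by
    intro x r K a hr hK h
    have h1 := norm_setIntegral_le_of_norm_le_const_ae' (μ := volume) (s := ball x r)
      (f := fun y => |f y - a|) (C := K) measure_ball_lt_top
      (by simpa only [Real.norm_eq_abs, abs_abs] using h)
    rw [measureReal_def, volume_ball_toReal n x hr] at h1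
    calc (∫ y in ball x r, |f y - a|) ≤ K * (r ^ n * unitBallVolume n) :=
          (le_abs_self _).trans h1
      _ ≤ (2 * N * r ^ α) * (r ^ n * unitBallVolume n) := by gcongr
      _ = (2 * unitBallVolume n) * N * r ^ ((n : ℝ) + α) := by
          rw [Real.rpow_add hr, Real.rpow_natCast]; ring
      _ ≤ C * N * r ^ ((n : ℝ) + α) := by gcongr
  constructor
  · intro x r hr
    refine hint x r (N * (2 * r) ^ α) _ hr ?_ ?_
    · rw [Real.mul_rpow (by norm_num) hr.le]
      have h2 : (2 : ℝ) ^ α ≤ 2 := by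
        simpa using Real.rpow_le_rpow_of_exponent_le (one_le_two (α := ℝ)) hα1.le
      have : 0 ≤ N * r ^ α := by positivity
      nlinarith
    · filter_upwards [hfg] with y hy hyB
      have hv := volume_ball_toReal_pos n x hr
      have h1 := norm_setIntegral_le_of_norm_le_const_ae' (μ := volume) (s := ball x r)
        (f := fun z => f z - f y) (C := N * (2 * r) ^ α) measure_ball_lt_top (by
          filter_upwards [hfg] with z hz hzB
          rw [hz, hy, Real.norm_eq_abs]
          refine (hg.1 z y).trans ?_
          gcongr
          have := dist_triangle_right z y x
          rw [mem_ball] at hzB hyB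
          linarith)
      rw [integral_sub (integrableOn_ball hf x r) (integrableOn_const measure_ball_lt_top.ne),
        setIntegral_const, smul_eq_mul, Real.norm_eq_abs, measureReal_def] at h1
      rw [abs_sub_comm]
      rw [← mul_le_mul_iff_left₀ hv]
      refine le_trans (le_of_eq ?_) h1
      rw [← abs_of_pos hv, ← abs_mul, abs_of_pos hv, sub_mul, mul_right_comm,
        inv_mul_cancel₀ hv.ne', one_mul, mul_comm (f y)]
  · intro x r hr
    have hρ0 : 0 ≤ criticalRadius n V x := Real.sSup_nonneg fun r hr => hr.1.le
    rcases (hρ0.trans hr).eq_or_lt with rfl | hr0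
    · rw [ball_zero, setIntegral_empty, Real.zero_rpow (by positivity), mul_zero]
    · have := hint x r (2 * N * r ^ α) 0 hr0 le_rfl (by
        filter_upwards [hfg] with y hy hyB
        rw [sub_zero, hy]
        have e1 : |g x| ≤ N * r ^ α := (hg.2 x).trans (by gcongr)
        have e2 : |g y - g x| ≤ N * r ^ α := (hg.1 y x).trans (by
          gcongr
          exact (mem_ball.1 hyB).le)
        have := abs_add_le (g y - g x) (g x)
        rw [sub_add_cancel] at this
        linarith)
      simpa only [sub_zero] using this

/-- For `0 < α < 1`, `BMO^α_𝓛(ℝⁿ) = Λ^α_𝓛(ℝⁿ)` with equivalent norms. -/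
theorem statement19 (n : ℕ) (hn : 3 ≤ n) (q : ℝ) (hq : (n : ℝ) / 2 < q)
    (V : En n → ℝ) (hV : ReverseHolder n q V)
    (hV0 : ¬ (∀ᵐ x ∂(volume : Measure (En n)), V x = 0))
    (α : ℝ) (hα : 0 < α) (hα1 : α < 1) :
    ∃ C : ℝ, 1 ≤ C ∧
      ∀ f : En n → ℝ, LocallyIntegrable f volume →
        (∀ M : ℝ, 0 ≤ M → BMOAlphaBound n V α f M →
          ∃ g : En n → ℝ, (∀ᵐ x ∂(volume : Measure (En n)), f x = g x) ∧
            LambdaBound n V α g (C * M)) ∧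
        (∀ (g : En n → ℝ) (N : ℝ), 0 ≤ N →
          (∀ᵐ x ∂(volume : Measure (En n)), f x = g x) →
          LambdaBound n V α g N → BMOAlphaBound n V α f (C * N)) := by
  have hc := unitBallVolume_pos n
  have hβ : 0 < 1 - ((1 : ℝ) / 2) ^ α :=
    sub_pos.2 (Real.rpow_lt_one (by norm_num) (by norm_num) hα)
  have hK : 0 ≤ 2 * ((2 ^ n / unitBallVolume n) / (1 - ((1 : ℝ) / 2) ^ α) +
      2 ^ ((n : ℝ) + α) / unitBallVolume n) + (unitBallVolume n)⁻¹ := by positivity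
  refine ⟨1 + (2 * ((2 ^ n / unitBallVolume n) / (1 - ((1 : ℝ) / 2) ^ α) +
      2 ^ ((n : ℝ) + α) / unitBallVolume n) + (unitBallVolume n)⁻¹) + 2 * unitBallVolume n,
    by linarith, fun f hf => ⟨fun M hM h => ?_, fun g N hN hfg hg => ?_⟩⟩
  · exact exists_lambdaBound_of_bmoAlphaBound hα hf hM (by linarith) h
  · exact bmoAlphaBound_of_lambdaBound hα hα1 hf hN (by linarith) hfg hg
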